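/- arXiv:1009.4042 — 3 statements merged into one kernel-verified Lean document; each statement's English description precedes it below -/
import Mathlib

section
/- Let 0 < s < 1 and t > 0 be fixed, and let P^{(s)}(x,t) denote the fractional heat kernel on ℝ. Then P^{(s)}(x,t) is real-valued and even in x, P^{(s)}(x,t) > 0 for all x ∈ ℝ, and P^{(s)}(·,t) is strictly decreasing on (0, ∞): for 0 < x₁ < x₂ one has P^{(s)}(x₂,t) < P^{(s)}(x₁,t). -/
/-!
Statement 15: The fractional heat kernel `P^{(s)}(x,t)` is real-valued and even in `x`,
strictly positive, and strictly decreasing on `(0,∞)`.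
-/

open MeasureTheory Real

noncomputable section

/-- The fractional heat kernel
`P^{(s)}(x,t) = (2π)^{-1/2} ∫ e^{-t|ξ|^{2s}} e^{-iξx} dξ`. -/
def heatK (s x t : ℝ) : ℂ :=
  (Real.sqrt (2 * Real.pi))⁻¹ •
    ∫ ξ : ℝ, Complex.exp (((-(t * |ξ| ^ (2 * s)) : ℝ) : ℂ) - Complex.I * (ξ : ℂ) * (x : ℂ))

open Filter Topology

def LapSum (f : ℝ → ℝ) : Prop :=
  ∃ (ι : Type) (_ : Countable ι) (w u : ι → ℝ), (∀ i, 0 ≤ w i) ∧ (∀ i, 0 ≤ u i) ∧ Summable w ∧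
    ∀ l : ℝ, 0 < l → HasSum (fun i => w i * Real.exp (-(l * u i))) (f l)

lemma LapSum.one : LapSum (fun _ => 1) := by
  refine ⟨Unit, inferInstance, fun _ => 1, fun _ => 0, by simp, by simp, ?_, ?_⟩
  · exact (hasSum_fintype _).summable
  · intro l _
    simpa using hasSum_fintype (fun _ : Unit => (1:ℝ))

lemma LapSum.mul {f g : ℝ → ℝ} (hf : LapSum f) (hg : LapSum g) : LapSum (fun l => f l * g l) := by
  obtain ⟨ι, hι, w, u, hw, hu, hs, h⟩ := hf
  obtain ⟨κ, hκ, w', u', hw', hu', hs', h'⟩ := hg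
  refine ⟨ι × κ, inferInstance, fun p => w p.1 * w' p.2, fun p => u p.1 + u' p.2,
    fun p => mul_nonneg (hw _) (hw' _), fun p => add_nonneg (hu _) (hu' _),
    hs.mul_of_nonneg hs' hw hw', ?_⟩
  intro l hl
  have a := h l hl
  have b := h' l hl
  have c := a.mul b (a.summable.mul_of_nonneg b.summable
    (fun i => mul_nonneg (hw i) (Real.exp_pos _).le)
    (fun i => mul_nonneg (hw' i) (Real.exp_pos _).le))
  refine c.congr_fun ?_ |> id
  intro p
  rw [mul_add, neg_add, Real.exp_add]
  ring

lemma LapSum.pow {f : ℝ → ℝ} (hf : LapSum f) (n : ℕ) : LapSum (fun l => f l ^ n) := by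
  induction n with
  | zero => simpa using LapSum.one
  | succ n ih => simpa [pow_succ] using ih.mul hf

lemma LapSum.scale {f : ℝ → ℝ} (hf : LapSum f) {h : ℝ} (hh : 0 < h) :
    LapSum (fun l => f (l * h)) := by
  obtain ⟨ι, hι, w, u, hw, hu, hs, H⟩ := hf
  refine ⟨ι, hι, w, fun i => h * u i, hw, fun i => mul_nonneg hh.le (hu i), hs, ?_⟩
  intro l hl
  simpa [mul_assoc] using H (l * h) (mul_pos hl hh)

lemma choose_rec (s : ℝ) (k : ℕ) :
    ((k : ℝ) + 1) * Ring.choose s (k + 1) = (s - k) * Ring.choose s k := by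
  have h1 := Ring.descPochhammer_eq_factorial_smul_choose s (k + 1)
  have h2 := Ring.descPochhammer_eq_factorial_smul_choose s k
  rw [descPochhammer_succ_right, Polynomial.smeval_mul, h2] at h1
  simp [Polynomial.smeval_sub, Nat.factorial_succ, Polynomial.smeval_natCast] at h1
  have : (k.factorial : ℝ) ≠ 0 := by positivity
  apply mul_left_cancel₀ this
  linarith

lemma base_coef {s : ℝ} (hs0 : 0 < s) (hs1 : s < 1) (k : ℕ) :
    0 ≤ -((-1) ^ (k + 1) * Ring.choose s (k + 1)) := by
  induction k with
  | zero => simp; exact hs0.le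
  | succ k ih =>
    have h := choose_rec s (k + 1)
    push_cast at h
    have h3 : ((k : ℝ) + 1 + 1) * -((-1) ^ (k + 1 + 1) * Ring.choose s (k + 1 + 1))
      = ((k : ℝ) + 1 - s) * -((-1) ^ (k + 1) * Ring.choose s (k + 1)) := by
      rw [pow_succ _ (k+1)]
      linear_combination ((-1) ^ (k + 1) ) * h
    have h4 : 0 ≤ ((k : ℝ) + 1 - s) * -((-1) ^ (k + 1) * Ring.choose s (k + 1)) :=
      mul_nonneg (by have : (0:ℝ) ≤ k := by positivity
                     linarith) ih
    rw [← h3] at h4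
    exact nonneg_of_mul_nonneg_right h4 (by positivity)

lemma base_hasSum {s z : ℝ} (hz0 : 0 ≤ z) (hz1 : z < 1) :
    HasSum (fun k : ℕ => -((-1) ^ (k + 1) * Ring.choose s (k + 1)) * z ^ (k + 1))
      (1 - (1 - z) ^ s) := by
  have h := (Real.one_add_rpow_hasFPowerSeriesOnBall_zero (a := s)).hasSum (y := -z) (by
    rw [← ENNReal.ofReal_one, Metric.eball_ofReal, Metric.mem_ball, dist_zero_right, norm_neg,
      Real.norm_eq_abs, abs_of_nonneg hz0]
    exact hz1)
  simp [binomialSeries, FormalMultilinearSeries.coeff_ofScalars] at h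
  rw [← hasSum_nat_add_iff' 1] at h
  have h2 := h.neg
  simp at h2
  convert! h2 using 1
  · funext k
    rw [neg_pow z]; ring
  
lemma LapSum.base {s : ℝ} (hs0 : 0 < s) (hs1 : s < 1) :
    LapSum (fun l => 1 - (1 - Real.exp (-l)) ^ s) := by
  refine ⟨ℕ, inferInstance, fun k => -((-1) ^ (k + 1) * Ring.choose s (k + 1)),
    fun k => (k : ℝ) + 1, base_coef hs0 hs1, fun k => by positivity, ?_, ?_⟩
  · refine summable_of_sum_range_le (c := 1) (base_coef hs0 hs1) ?_
    intro n
    have hc : Tendsto (fun z : ℝ => ∑ k ∈ Finset.range n,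
        -((-1) ^ (k + 1) * Ring.choose s (k + 1)) * z ^ (k + 1)) (𝓝[<] 1)
        (𝓝 (∑ k ∈ Finset.range n, -((-1) ^ (k + 1) * Ring.choose s (k + 1)) * 1 ^ (k + 1))) := by
      apply Tendsto.mono_left _ nhdsWithin_le_nhds
      apply Continuous.tendsto
      fun_prop
    have := le_of_tendsto hc (b := 1) ?_
    · simpa using this
    · have h1 : ∀ᶠ z : ℝ in 𝓝[<] 1, 0 < z :=
        nhdsWithin_le_nhds (lt_mem_nhds one_pos)
      filter_upwards [self_mem_nhdsWithin, h1] with z hz1 hz0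
      have hz1 : z < 1 := hz1
      have hS := base_hasSum (s := s) hz0.le hz1
      refine (sum_le_hasSum _ (fun i _ => mul_nonneg (base_coef hs0 hs1 i) (by positivity)) hS).trans ?_
      have : 0 ≤ (1 - z) ^ s := Real.rpow_nonneg (by linarith) _
      linarith
  · intro l hl
    have hS := base_hasSum (s := s) (Real.exp_pos (-l)).le (by rw [Real.exp_lt_one_iff]; linarith)
    convert hS using 2 with k
    rw [← Real.exp_nat_mul]
    push_cast
    ring_nf

lemma gauss_cos {v : ℝ} (hv : 0 < v) (x : ℝ) :
    ∫ ξ : ℝ, Real.exp (-(v * ξ ^ 2)) * Real.cos (ξ * x) =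
      Real.sqrt (Real.pi / v) * Real.exp (-(x ^ 2 / (4 * v))) := by
  have h := fourierIntegral_gaussian (b := (v : ℂ)) (by simpa using hv) (x : ℂ)
  have hi : Integrable (fun ξ : ℝ => Complex.exp (Complex.I * x * ξ) * Complex.exp (-(v : ℂ) * ξ ^ 2)) := by
    have h0 := (integrable_exp_neg_mul_sq hv)
    refine h0.mono' (by fun_prop) (Eventually.of_forall fun ξ => ?_)
    rw [norm_mul, Complex.norm_exp, Complex.norm_exp]
    simp [← Complex.ofReal_pow, ← Complex.ofReal_mul, ← Complex.ofReal_neg]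
  have h2 := congrArg Complex.re h
  have h3 : (∫ ξ : ℝ, Complex.exp (Complex.I * x * ξ) * Complex.exp (-(v : ℂ) * ξ ^ 2)).re
     = ∫ ξ : ℝ, (Complex.exp (Complex.I * x * ξ) * Complex.exp (-(v : ℂ) * ξ ^ 2)).re :=
    (integral_re (𝕜 := ℂ) hi).symm
  rw [h3] at h2
  have h4 : ((Real.pi / v : ℂ) ^ (1 / 2 : ℂ) * Complex.exp (-(x:ℂ) ^ 2 / (4 * v))) =
    ((Real.sqrt (Real.pi / v) * Real.exp (-(x ^ 2 / (4 * v))) : ℝ) : ℂ) := by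
    rw [Real.sqrt_eq_rpow, Complex.ofReal_mul, Complex.ofReal_cpow (by positivity), Complex.ofReal_exp]
    push_cast
    ring_nf
  rw [h4, Complex.ofReal_re] at h2
  rw [← h2]
  congr 1
  ext ξ
  rw [← Complex.exp_add, Complex.exp_re]
  simp [← Complex.ofReal_pow]
  rw [mul_comm]

lemma lower_bound {x₁ x₂ a : ℝ} (h1 : 0 ≤ x₁) (h2 : x₁ < x₂) (ha : 0 < a) :
    ∃ c : ℝ, 0 < c ∧ ∀ v, a ≤ v → c * Real.exp (-(2 * v)) ≤
      Real.sqrt (Real.pi / v) * Real.exp (-(x₁ ^ 2 / (4 * v))) -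
      Real.sqrt (Real.pi / v) * Real.exp (-(x₂ ^ 2 / (4 * v))) := by
  have hq : 0 < (x₂ ^ 2 - x₁ ^ 2) / 4 := by nlinarith
  refine ⟨Real.exp (-(x₂ ^ 2 / (4 * a))) * ((x₂ ^ 2 - x₁ ^ 2) / 4), by positivity, ?_⟩
  intro v hv
  have hv0 : 0 < v := ha.trans_le hv
  have e1 : Real.exp (-(x₁ ^ 2 / (4 * v))) =
      Real.exp (-(x₂ ^ 2 / (4 * v))) * Real.exp ((x₂ ^ 2 - x₁ ^ 2) / 4 / v) := by
    rw [← Real.exp_add]; congr 1; field_simp; ring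
  have e2 : (x₂ ^ 2 - x₁ ^ 2) / 4 / v + 1 ≤ Real.exp ((x₂ ^ 2 - x₁ ^ 2) / 4 / v) :=
    Real.add_one_le_exp _
  have e3 : Real.exp (-(x₂ ^ 2 / (4 * a))) ≤ Real.exp (-(x₂ ^ 2 / (4 * v))) := by
    apply Real.exp_le_exp.2
    apply neg_le_neg
    gcongr
  have e4 : Real.exp (-v) ≤ Real.sqrt (Real.pi / v) := by
    apply Real.le_sqrt_of_sq_le
    rw [le_div_iff₀ hv0]
    have : Real.exp (-v) ≤ 1 := Real.exp_le_one_iff.2 (by linarith)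
    have h5 : v * Real.exp (-v) ≤ 1 := by
      rw [Real.exp_neg, ← div_eq_mul_inv, div_le_one (Real.exp_pos _)]
      linarith [Real.add_one_le_exp v]
    have := Real.pi_gt_three
    nlinarith [Real.exp_pos (-v)]
  have e5 : Real.exp (-v) ≤ 1 / v := by
    rw [Real.exp_neg, ← one_div]
    apply one_div_le_one_div_of_le hv0
    linarith [Real.add_one_le_exp v]
  calc Real.exp (-(x₂ ^ 2 / (4 * a))) * ((x₂ ^ 2 - x₁ ^ 2) / 4) * Real.exp (-(2 * v))
      = Real.exp (-v) * (Real.exp (-(x₂ ^ 2 / (4 * a))) * (((x₂ ^ 2 - x₁ ^ 2) / 4) * Real.exp (-v))) := by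
        rw [show -(2 * v) = -v + -v by ring, Real.exp_add]; ring
    _ ≤ Real.sqrt (Real.pi / v) * (Real.exp (-(x₂ ^ 2 / (4 * v))) * (((x₂ ^ 2 - x₁ ^ 2) / 4) * (1 / v))) := by
        gcongr
    _ ≤ Real.sqrt (Real.pi / v) * (Real.exp (-(x₂ ^ 2 / (4 * v))) * (Real.exp ((x₂ ^ 2 - x₁ ^ 2) / 4 / v) - 1)) := by
        gcongr
        rw [mul_one_div]; linarith
    _ = _ := by rw [e1]; ring

lemma LapSum.kernel {f : ℝ → ℝ} (hf : LapSum f) {δ : ℝ} (hδ : 0 < δ) :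
    ∃ (ι : Type) (w u : ι → ℝ), (∀ i, 0 ≤ w i) ∧ (∀ i, 0 ≤ u i) ∧
    (∀ l : ℝ, 0 < l → HasSum (fun i => w i * Real.exp (-(l * u i))) (f l)) ∧
    ∀ x : ℝ, HasSum (fun i => w i * (Real.sqrt (Real.pi / (u i + δ)) *
        Real.exp (-(x ^ 2 / (4 * (u i + δ))))))
      (∫ ξ : ℝ, Real.exp (-(δ * ξ ^ 2)) * f (ξ ^ 2) * Real.cos (ξ * x)) := by
  obtain ⟨ι, hι, w, u, hw, hu, hs, H⟩ := hf
  refine ⟨ι, w, u, hw, hu, H, fun x => ?_⟩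
  have hg : Integrable (fun ξ : ℝ => Real.exp (-(δ * ξ ^ 2))) := by
    simpa using integrable_exp_neg_mul_sq hδ
  have hb : ∀ i (ξ : ℝ), ‖w i * (Real.exp (-((u i + δ) * ξ ^ 2)) * Real.cos (ξ * x))‖ ≤
      w i * Real.exp (-(δ * ξ ^ 2)) := by
    intro i ξ
    rw [norm_mul, norm_mul, Real.norm_of_nonneg (hw i), Real.norm_of_nonneg (Real.exp_pos _).le]
    have h1 : ‖Real.cos (ξ * x)‖ ≤ 1 := Real.abs_cos_le_one _
    have h2 : Real.exp (-((u i + δ) * ξ ^ 2)) ≤ Real.exp (-(δ * ξ ^ 2)) := by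
      apply Real.exp_le_exp.2
      nlinarith [mul_nonneg (hu i) (sq_nonneg ξ)]
    apply mul_le_mul_of_nonneg_left _ (hw i)
    calc _ ≤ Real.exp (-(δ * ξ ^ 2)) * 1 := by gcongr
      _ = _ := mul_one _
  have hint : ∀ i, Integrable (fun ξ : ℝ => w i * (Real.exp (-((u i + δ) * ξ ^ 2)) * Real.cos (ξ * x))) :=
    fun i => (hg.const_mul (w i)).mono' (by fun_prop) (Eventually.of_forall (hb i))
  have key := hasSum_integral_of_summable_integral_norm hint (by
    refine Summable.of_nonneg_of_le (fun i => integral_nonneg fun _ => norm_nonneg _) (fun i => ?_)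
      (hs.mul_right (∫ ξ : ℝ, Real.exp (-(δ * ξ ^ 2))))
    rw [← integral_const_mul]
    exact integral_mono (hint i).norm (hg.const_mul _) (hb i))
  have e1 : (fun i => ∫ ξ : ℝ, w i * (Real.exp (-((u i + δ) * ξ ^ 2)) * Real.cos (ξ * x))) =
     (fun i => w i * (Real.sqrt (Real.pi / (u i + δ)) *
        Real.exp (-(x ^ 2 / (4 * (u i + δ)))))) := by
    ext i
    rw [integral_const_mul, gauss_cos (by linarith [hu i])]
  rw [e1] at key
  convert! key using 1
  apply integral_congr_ae
  have : ∀ᵐ ξ : ℝ, ξ ≠ 0 := by simp [ae_iff]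
  filter_upwards [this] with ξ hξ
  have h3 := ((H (ξ ^ 2) (by positivity)).mul_left (Real.exp (-(δ * ξ ^ 2)))).mul_right (Real.cos (ξ * x))
  rw [← h3.tsum_eq]
  congr 1
  ext i
  rw [show -((u i + δ) * ξ ^ 2) = -(δ * ξ ^ 2) + -(ξ ^ 2 * u i) by ring, Real.exp_add]
  ring

lemma approx_tendsto {s t l : ℝ} (hs0 : 0 < s) (ht : 0 < t) (hl : 0 < l) :
    Tendsto (fun n : ℕ => (1 - (1 - Real.exp (-(l * (t / n) ^ s⁻¹))) ^ s) ^ n) atTop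
      (𝓝 (Real.exp (-(t * l ^ s)))) := by
  have hh : Tendsto (fun n : ℕ => (t / n) ^ s⁻¹) atTop (𝓝[>] 0) := by
    rw [tendsto_nhdsWithin_iff]
    constructor
    · have h1 : Tendsto (fun n : ℕ => t / (n : ℝ)) atTop (𝓝 0) := tendsto_const_div_atTop_nhds_zero_nat t
      have h2 := h1.rpow_const (p := s⁻¹) (Or.inr (inv_pos.2 hs0).le)
      rwa [Real.zero_rpow (inv_pos.2 hs0).ne'] at h2
    · filter_upwards [eventually_gt_atTop 0] with n hn
      have : (0:ℝ) < n := by exact_mod_cast hn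
      exact Real.rpow_pos_of_pos (by positivity) _
  have hd : Tendsto (fun h : ℝ => (1 - Real.exp (-(l * h))) / h) (𝓝[>] 0) (𝓝 l) := by
    have : HasDerivAt (fun h : ℝ => 1 - Real.exp (-(l * h))) l 0 := by
      have := (((hasDerivAt_id (0:ℝ)).const_mul l).neg.exp).const_sub 1
      simpa using this
    have h2 := this.tendsto_slope_zero_right
    simpa [div_eq_inv_mul] using h2
  have hc := ((hd.comp hh).rpow_const (p := s) (Or.inr hs0.le)).const_mul t |>.neg
  have := Real.tendsto_one_add_pow_exp_of_tendsto
    (g := fun n : ℕ => -(1 - Real.exp (-(l * (t / n) ^ s⁻¹))) ^ s) (t := -(t * l ^ s)) ?_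
  · simpa [sub_eq_add_neg] using this
  · refine hc.congr' ?_
    filter_upwards [eventually_gt_atTop 0] with n hn
    have hn0 : (0:ℝ) < n := by exact_mod_cast hn
    have hp : 0 < (t / n) ^ s⁻¹ := Real.rpow_pos_of_pos (by positivity) _
    have h1 : 0 ≤ 1 - Real.exp (-(l * (t / n) ^ s⁻¹)) := by
      have : Real.exp (-(l * (t / n) ^ s⁻¹)) ≤ 1 := Real.exp_le_one_iff.2 (by nlinarith)
      linarith
    simp only [Function.comp]
    rw [Real.div_rpow h1 hp.le, ← Real.rpow_mul (by positivity), inv_mul_cancel₀ hs0.ne', Real.rpow_one]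
    field_simp

lemma integrable_main {s t : ℝ} (hs0 : 0 < s) (ht : 0 < t) :
    Integrable (fun ξ : ℝ => Real.exp (-(t * |ξ| ^ (2 * s)))) := by
  have h1 := integrableOn_rpow_mul_exp_neg_mul_rpow (p := 2 * s) (s := 0) (b := t)
    (by norm_num) (by linarith) ht
  have h2 : IntegrableOn (fun ξ : ℝ => Real.exp (-(t * |ξ| ^ (2 * s)))) (Set.Ioi 0) := by
    refine h1.congr_fun (fun x hx => ?_) measurableSet_Ioi
    simp [abs_of_pos (show (0:ℝ) < x from hx)]
  rw [← integrableOn_univ, ← Set.Iic_union_Ioi (a := (0:ℝ)), integrableOn_union]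
  refine ⟨?_, h2⟩
  rw [integrableOn_Iic_iff_integrableOn_Iio]
  have := (Measure.measurePreserving_neg (volume : Measure ℝ)).integrableOn_comp_preimage
    (Homeomorph.neg ℝ).measurableEmbedding (f := fun ξ : ℝ => Real.exp (-(t * |ξ| ^ (2 * s)))) (s := Set.Ioi 0)
  rw [← this] at h2
  simpa [Function.comp_def] using h2

def KK (s t x : ℝ) : ℝ := ∫ ξ : ℝ, Real.exp (-(t * |ξ| ^ (2 * s))) * Real.cos (ξ * x)

lemma sq_rpow (s ξ : ℝ) : (ξ ^ 2) ^ s = |ξ| ^ (2 * s) := by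
  rw [← sq_abs, ← Real.rpow_natCast, ← Real.rpow_mul (abs_nonneg _)]
  norm_num

lemma lim1 {s t : ℝ} (hs0 : 0 < s) (ht : 0 < t) {δ : ℝ} (hδ : 0 < δ) (x : ℝ) :
    Tendsto (fun n : ℕ => ∫ ξ : ℝ, Real.exp (-(δ * ξ ^ 2)) *
      (1 - (1 - Real.exp (-(ξ ^ 2 * (t / n) ^ s⁻¹))) ^ s) ^ n * Real.cos (ξ * x)) atTop
     (𝓝 (∫ ξ : ℝ, Real.exp (-(δ * ξ ^ 2)) * Real.exp (-(t * |ξ| ^ (2 * s))) * Real.cos (ξ * x))) := by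
  refine tendsto_integral_of_dominated_convergence (fun ξ : ℝ => Real.exp (-(δ * ξ ^ 2))) ?_ ?_ ?_ ?_
  · intro n
    apply Measurable.aestronglyMeasurable
    fun_prop
  · simpa using integrable_exp_neg_mul_sq hδ
  · intro n
    refine Eventually.of_forall fun ξ => ?_
    have hp : 0 ≤ (t / n) ^ s⁻¹ := Real.rpow_nonneg (by positivity) _
    have h0 : Real.exp (-(ξ ^ 2 * (t / n) ^ s⁻¹)) ≤ 1 :=
      Real.exp_le_one_iff.2 (by nlinarith [mul_nonneg (sq_nonneg ξ) hp])
    have h0' := Real.exp_pos (-(ξ ^ 2 * (t / n) ^ s⁻¹))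
    have h1 : (1 - Real.exp (-(ξ ^ 2 * (t / n) ^ s⁻¹))) ^ s ≤ 1 :=
      Real.rpow_le_one (by linarith) (by linarith) hs0.le
    have h2 : 0 ≤ (1 - Real.exp (-(ξ ^ 2 * (t / n) ^ s⁻¹))) ^ s := Real.rpow_nonneg (by linarith) _
    have h3 : (1 - (1 - Real.exp (-(ξ ^ 2 * (t / n) ^ s⁻¹))) ^ s) ^ n ≤ 1 :=
      pow_le_one₀ (by linarith) (by linarith)
    have h4 : 0 ≤ (1 - (1 - Real.exp (-(ξ ^ 2 * (t / n) ^ s⁻¹))) ^ s) ^ n :=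
      pow_nonneg (by linarith) _
    rw [norm_mul, norm_mul, Real.norm_of_nonneg (Real.exp_pos _).le, Real.norm_of_nonneg h4]
    have h5 : ‖Real.cos (ξ * x)‖ ≤ 1 := Real.abs_cos_le_one _
    calc _ ≤ Real.exp (-(δ * ξ ^ 2)) * 1 * 1 := by gcongr
      _ = _ := by ring
  · have : ∀ᵐ ξ : ℝ, ξ ≠ 0 := by simp [ae_iff]
    filter_upwards [this] with ξ hξ
    have h := approx_tendsto (l := ξ ^ 2) hs0 ht (by positivity)
    rw [sq_rpow] at h
    exact (h.const_mul _).mul_const _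

lemma lim2 {s t : ℝ} (hs0 : 0 < s) (ht : 0 < t) (x : ℝ) :
    Tendsto (fun δ : ℝ => ∫ ξ : ℝ, Real.exp (-(δ * ξ ^ 2)) * Real.exp (-(t * |ξ| ^ (2 * s))) *
      Real.cos (ξ * x)) (𝓝[>] 0) (𝓝 (KK s t x)) := by
  refine tendsto_integral_filter_of_dominated_convergence
    (fun ξ : ℝ => Real.exp (-(t * |ξ| ^ (2 * s)))) ?_ ?_ (integrable_main hs0 ht) ?_
  · refine Eventually.of_forall fun δ => Measurable.aestronglyMeasurable ?_
    fun_prop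
  · filter_upwards [self_mem_nhdsWithin] with δ hδ
    have hδ : 0 < δ := hδ
    refine Eventually.of_forall fun ξ => ?_
    have h0 : Real.exp (-(δ * ξ ^ 2)) ≤ 1 := Real.exp_le_one_iff.2 (by nlinarith [mul_nonneg hδ.le (sq_nonneg ξ)])
    rw [norm_mul, norm_mul, Real.norm_of_nonneg (Real.exp_pos _).le, Real.norm_of_nonneg (Real.exp_pos _).le]
    have h5 : ‖Real.cos (ξ * x)‖ ≤ 1 := Real.abs_cos_le_one _
    calc _ ≤ 1 * Real.exp (-(t * |ξ| ^ (2 * s))) * 1 := by gcongr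
      _ = _ := by ring
  · refine Eventually.of_forall fun ξ => ?_
    apply Tendsto.mono_left _ nhdsWithin_le_nhds
    have : Continuous (fun δ : ℝ => Real.exp (-(δ * ξ ^ 2)) * Real.exp (-(t * |ξ| ^ (2 * s))) *
      Real.cos (ξ * x)) := by fun_prop
    simpa using this.tendsto 0

lemma approx_lap {s t : ℝ} (hs0 : 0 < s) (hs1 : s < 1) (ht : 0 < t) {n : ℕ} (hn : 0 < n) :
    LapSum (fun l => (1 - (1 - Real.exp (-(l * (t / n) ^ s⁻¹))) ^ s) ^ n) := by
  have hn0 : (0:ℝ) < n := by exact_mod_cast hn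
  exact ((LapSum.base hs0 hs1).scale (Real.rpow_pos_of_pos (div_pos ht hn0) s⁻¹)).pow n

lemma KK_nonneg {s t : ℝ} (hs0 : 0 < s) (hs1 : s < 1) (ht : 0 < t) (x : ℝ) : 0 ≤ KK s t x := by
  refine ge_of_tendsto (lim2 hs0 ht x) ?_
  filter_upwards [self_mem_nhdsWithin] with δ hδ
  have hδ : 0 < δ := hδ
  refine ge_of_tendsto (lim1 hs0 ht hδ x) ?_
  filter_upwards [eventually_gt_atTop 0] with n hn
  obtain ⟨ι, w, u, hw, hu, -, h⟩ := (approx_lap hs0 hs1 ht hn).kernel hδ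
  exact (h x).nonneg fun i => mul_nonneg (hw i) (by positivity)

lemma KK_strict {s t : ℝ} (hs0 : 0 < s) (hs1 : s < 1) (ht : 0 < t) {x₁ x₂ : ℝ}
    (h1 : 0 ≤ x₁) (h2 : x₁ < x₂) : KK s t x₂ < KK s t x₁ := by
  obtain ⟨M, hM, hM2⟩ : ∃ M : ℝ, 1 + t * 2 ^ s < t * M ^ s ∧ 2 < M := by
    have := (tendsto_rpow_atTop hs0).const_mul_atTop ht
    exact ((this.eventually_gt_atTop _).and (eventually_gt_atTop 2)).exists
  have ha : 0 < 1 / (M - 2) := one_div_pos.2 (by linarith)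
  obtain ⟨c, hc, hlow⟩ := lower_bound h1 h2 ha
  set c' := c * Real.exp (-2) with hc'
  have hc'0 : 0 < c' := by positivity
  have hpos : 0 < c' * (Real.exp (-(t * 2 ^ s)) - Real.exp 1 * Real.exp (-(t * M ^ s))) := by
    apply mul_pos hc'0
    rw [← Real.exp_add, sub_pos]
    apply Real.exp_lt_exp.2
    linarith
  suffices c' * (Real.exp (-(t * 2 ^ s)) - Real.exp 1 * Real.exp (-(t * M ^ s))) ≤
      KK s t x₁ - KK s t x₂ by linarith
  refine ge_of_tendsto ((lim2 hs0 ht x₁).sub (lim2 hs0 ht x₂)) ?_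
  have hlt : ∀ᶠ δ : ℝ in 𝓝[>] 0, δ < 1 := nhdsWithin_le_nhds (gt_mem_nhds one_pos)
  filter_upwards [self_mem_nhdsWithin, hlt] with δ hδ hδ1
  have hδ : 0 < δ := hδ
  refine le_of_tendsto_of_tendsto
    (((approx_tendsto hs0 ht two_pos).sub ((approx_tendsto hs0 ht
      (show 0 < M by linarith)).const_mul (Real.exp 1))).const_mul c')
    ((lim1 hs0 ht hδ x₁).sub (lim1 hs0 ht hδ x₂)) ?_
  filter_upwards [eventually_gt_atTop 0] with n hn
  obtain ⟨ι, w, u, hw, hu, H, h⟩ := (approx_lap hs0 hs1 ht hn).kernel hδ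
  refine hasSum_le ?_ (((H 2 two_pos).sub ((H M (by linarith)).mul_left (Real.exp 1))).mul_left c')
    ((h x₁).sub (h x₂))
  intro i
  have hui := hu i
  rw [← mul_sub]
  have e : c' * (w i * Real.exp (-(2 * u i)) - Real.exp 1 * (w i * Real.exp (-(M * u i)))) =
     w i * (c' * (Real.exp (-(2 * u i)) - Real.exp 1 * Real.exp (-(M * u i)))) := by ring
  rw [e]
  apply mul_le_mul_of_nonneg_left _ (hw i)
  by_cases hcase : 1 / (M - 2) ≤ u i
  · refine le_trans ?_ (hlow (u i + δ) (by linarith))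
    rw [hc', mul_assoc]
    apply mul_le_mul_of_nonneg_left _ hc.le
    calc Real.exp (-2) * (Real.exp (-(2 * u i)) - Real.exp 1 * Real.exp (-(M * u i)))
        ≤ Real.exp (-2) * Real.exp (-(2 * u i)) := by
          gcongr
          have : 0 < Real.exp 1 * Real.exp (-(M * u i)) := by positivity
          linarith
      _ ≤ Real.exp (-(2 * (u i + δ))) := by
          rw [← Real.exp_add]
          apply Real.exp_le_exp.2
          linarith
  · push Not at hcase
    rw [lt_div_iff₀ (by linarith)] at hcase
    have l1 : Real.exp (-(2 * u i)) ≤ Real.exp 1 * Real.exp (-(M * u i)) := by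
      rw [← Real.exp_add]
      apply Real.exp_le_exp.2
      linarith
    have l2 : c' * (Real.exp (-(2 * u i)) - Real.exp 1 * Real.exp (-(M * u i))) ≤ 0 :=
      mul_nonpos_of_nonneg_of_nonpos hc'0.le (by linarith)
    refine l2.trans ?_
    rw [← mul_sub]
    apply mul_nonneg (Real.sqrt_nonneg _)
    rw [sub_nonneg]
    apply Real.exp_le_exp.2
    apply neg_le_neg
    gcongr

lemma KK_neg (s t x : ℝ) : KK s t (-x) = KK s t x := by
  simp [KK]

lemma KK_abs (s t x : ℝ) : KK s t |x| = KK s t x := by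
  rcases abs_cases x with h | h <;> rw [h.1]
  exact KK_neg s t x

lemma heatK_neg (s x t : ℝ) : heatK s (-x) t = heatK s x t := by
  unfold heatK
  congr 1
  rw [← integral_neg_eq_self]
  congr 1
  ext ξ
  simp

lemma heatK_eq {s t : ℝ} (hs0 : 0 < s) (ht : 0 < t) (x : ℝ) :
    heatK s x t = (((Real.sqrt (2 * Real.pi))⁻¹ * KK s t x : ℝ) : ℂ) := by
  have hi : ∀ y : ℝ, Integrable (fun ξ : ℝ => Complex.exp (((-(t * |ξ| ^ (2 * s)) : ℝ) : ℂ) -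
      Complex.I * (ξ : ℂ) * (y : ℂ))) := by
    intro y
    refine (integrable_main hs0 ht).mono' (Measurable.aestronglyMeasurable (by fun_prop))
      (Eventually.of_forall fun ξ => ?_)
    rw [Complex.norm_exp]
    simp
  have h2 : heatK s x t = (1 / 2 : ℂ) * (heatK s x t + heatK s (-x) t) := by
    rw [heatK_neg]; ring
  rw [h2]
  unfold heatK
  rw [← smul_add, ← integral_add (hi x) (hi (-x)), Complex.ofReal_mul, KK, ← integral_complex_ofReal,
    Complex.real_smul, mul_left_comm, ← integral_const_mul]
  congr 2
  ext ξ
  push_cast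
  rw [sub_eq_add_neg, sub_eq_add_neg, Complex.exp_add, Complex.exp_add, Complex.cos]
  ring_nf

/-- For fixed `0 < s < 1` and `t > 0`, the fractional heat kernel
`P^{(s)}(·,t)` is real-valued, even, everywhere positive, and strictly decreasing on
the positive half-axis. -/
theorem heat_kernel_positive_unimodal (s t : ℝ) (hs0 : 0 < s) (hs1 : s < 1)
    (ht : 0 < t) :
    (∀ x : ℝ, (heatK s x t).im = 0) ∧
    (∀ x : ℝ, heatK s (-x) t = heatK s x t) ∧
    (∀ x : ℝ, 0 < (heatK s x t).re) ∧
    (∀ x₁ x₂ : ℝ, 0 < x₁ → x₁ < x₂ → (heatK s x₂ t).re < (heatK s x₁ t).re) := by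
  have hc : 0 < (Real.sqrt (2 * Real.pi))⁻¹ := by positivity
  have hre : ∀ x, (heatK s x t).re = (Real.sqrt (2 * Real.pi))⁻¹ * KK s t x := by
    intro x; rw [heatK_eq hs0 ht, Complex.ofReal_re]
  refine ⟨fun x => ?_, fun x => heatK_neg s x t, fun x => ?_, fun x₁ x₂ h1 h2 => ?_⟩
  · rw [heatK_eq hs0 ht, Complex.ofReal_im]
  · rw [hre, ← KK_abs]
    exact mul_pos hc ((KK_nonneg hs0 hs1 ht (|x| + 1)).trans_lt
      (KK_strict hs0 hs1 ht (abs_nonneg x) (lt_add_one _)))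
  · rw [hre, hre]
    exact mul_lt_mul_of_pos_left (KK_strict hs0 hs1 ht h1.le h2) hc

end
end

section
/- Let 0 < s₀ < 1 be fixed. Then there exists a constant C > 0 depending only on s₀ such that for all s with s₀ ≤ s < 1, all x ∈ ℝ, and all t > 0, the fractional heat kernel satisfies P^{(s)}(x,t) ≤ C · min{ t^{-1/(2s)}, |x|^{-1} } (the second bound being understood for x ≠ 0); equivalently, P^{(s)}(x,t) ≤ C t^{-1/(2s)} for all x, and |x| · P^{(s)}(x,t) ≤ C for all x ≠ 0. -/
/-!
Statement 16: Uniform pointwise bounds for the fractional heat kernel: for fixed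
`0 < s₀ < 1` there is `C = C(s₀) > 0` such that for all `s ∈ [s₀, 1)`, `t > 0`:
`P^{(s)}(x,t) ≤ C t^{-1/(2s)}` for all `x`, and `|x| P^{(s)}(x,t) ≤ C` for `x ≠ 0`.
-/

open MeasureTheory Real

noncomputable section

lemma expInt (s t : ℝ) (hs : 0 < s) (ht : 0 < t) :
    IntegrableOn (fun ξ : ℝ => Real.exp (-(t * ξ ^ (2 * s)))) (Set.Ioi 0) ∧
    ∫ ξ in Set.Ioi (0 : ℝ), Real.exp (-(t * ξ ^ (2 * s))) =
      t ^ (-(1 / (2 * s))) * Real.Gamma (1 / (2 * s) + 1) := by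
  have h := integral_exp_neg_mul_rpow (p := 2 * s) (b := t) (by positivity) ht
  simp only [neg_mul, neg_div] at h
  refine ⟨?_, h⟩
  by_contra hc
  rw [integral_undef hc] at h
  have : 0 < t ^ (-(1 / (2 * s))) * Real.Gamma (1 / (2 * s) + 1) :=
    mul_pos (Real.rpow_pos_of_pos ht _) (Real.Gamma_pos_of_pos (by positivity))
  linarith

/-- The half-line integrand. -/
def hInt (s t x ξ : ℝ) : ℂ :=
  ((Real.exp (-(t * ξ ^ (2 * s))) : ℝ) : ℂ) * Complex.exp (-(Complex.I * x) * ξ)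

lemma norm_cexp (x ξ : ℝ) : ‖Complex.exp (-(Complex.I * x) * ξ)‖ = 1 := by
  rw [Complex.norm_exp]
  simp

lemma norm_hInt (s t x ξ : ℝ) : ‖hInt s t x ξ‖ = Real.exp (-(t * ξ ^ (2 * s))) := by
  rw [hInt, norm_mul, norm_cexp, mul_one, Complex.norm_real, Real.norm_of_nonneg (Real.exp_pos _).le]

lemma half_split (s t x B : ℝ) (hB : 0 ≤ B)
    (h1 : ‖∫ ξ in Set.Ioi (0 : ℝ), hInt s t x ξ‖ ≤ B)
    (h2 : ‖∫ ξ in Set.Ioi (0 : ℝ), hInt s t (-x) ξ‖ ≤ B) :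
    ‖heatK s x t‖ ≤ 2 * B := by
  have hc : (Real.sqrt (2 * Real.pi))⁻¹ ≤ 1 := by
    apply inv_le_one_of_one_le₀
    rw [Real.one_le_sqrt]
    linarith [Real.pi_gt_three]
  have hc0 : 0 ≤ (Real.sqrt (2 * Real.pi))⁻¹ := by positivity
  unfold heatK
  rw [norm_smul, Real.norm_of_nonneg hc0]
  refine (mul_le_of_le_one_left (norm_nonneg _) hc).trans ?_
  set F : ℝ → ℂ := fun ξ => Complex.exp (((-(t * |ξ| ^ (2 * s)) : ℝ) : ℂ) -
    Complex.I * (ξ : ℂ) * (x : ℂ)) with hF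
  by_cases hi : Integrable F
  · rw [← intervalIntegral.integral_Iic_add_Ioi (b := (0 : ℝ)) hi.integrableOn hi.integrableOn]
    have e1 : ∫ ξ in Set.Ioi (0 : ℝ), F ξ = ∫ ξ in Set.Ioi (0 : ℝ), hInt s t x ξ := by
      refine setIntegral_congr_fun measurableSet_Ioi fun ξ hξ => ?_
      have : |ξ| = ξ := abs_of_pos hξ
      simp only [hF, hInt, this]
      rw [Complex.ofReal_exp, ← Complex.exp_add]
      congr 1
      ring
    have e2 : ∫ ξ in Set.Iic (0 : ℝ), F ξ = ∫ ξ in Set.Ioi (0 : ℝ), hInt s t (-x) ξ := by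
      rw [← neg_zero, ← integral_comp_neg_Ioi, neg_zero]
      refine setIntegral_congr_fun measurableSet_Ioi fun ξ hξ => ?_
      have : |ξ| = ξ := abs_of_pos hξ
      simp only [hF, hInt, abs_neg, this]
      rw [Complex.ofReal_exp, ← Complex.exp_add]
      congr 1
      push_cast
      ring
    rw [e1, e2]
    refine (norm_add_le _ _).trans ?_
    linarith
  · rw [integral_undef hi]
    simpa using hB

lemma half_bound1 (s t x : ℝ) (hs : 0 < s) (ht : 0 < t) :
    ‖∫ ξ in Set.Ioi (0 : ℝ), hInt s t x ξ‖ ≤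
      t ^ (-(1 / (2 * s))) * Real.Gamma (1 / (2 * s) + 1) := by
  rw [← (expInt s t hs ht).2]
  refine (norm_integral_le_integral_norm _).trans ?_
  simp only [norm_hInt, le_refl]

lemma half_bound2 (s t x : ℝ) (hs : 0 < s) (ht : 0 < t) (hx : x ≠ 0) :
    ‖∫ ξ in Set.Ioi (0 : ℝ), hInt s t x ξ‖ ≤ 2 * |x|⁻¹ := by
  set g : ℝ → ℝ := fun ξ => Real.exp (-(t * ξ ^ (2 * s))) with hg
  set g' : ℝ → ℝ := fun ξ => Real.exp (-(t * ξ ^ (2 * s))) * -(t * (2 * s * ξ ^ (2 * s - 1)))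
    with hg'
  have hgc : Continuous g := by
    have : Continuous fun ξ : ℝ => ξ ^ (2 * s) := Real.continuous_rpow_const (by positivity)
    fun_prop
  have hd : ∀ ξ ∈ Set.Ioi (0 : ℝ), HasDerivAt g (g' ξ) ξ := by
    intro ξ hξ
    exact (((Real.hasDerivAt_rpow_const (p := 2 * s) (Or.inl (ne_of_gt hξ))).const_mul t).neg).exp
  have hneg : ∀ ξ ∈ Set.Ioi (0 : ℝ), g' ξ ≤ 0 := by
    intro ξ hξ
    have hξ' : 0 < ξ := hξ
    simp only [hg', mul_neg, Left.neg_nonpos_iff]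
    positivity
  have hg0 : g 0 = 1 := by
    simp [hg, Real.zero_rpow (show 2 * s ≠ 0 by positivity)]
  have hlim : Filter.Tendsto g Filter.atTop (nhds 0) := by
    refine Real.tendsto_exp_atBot.comp (Filter.tendsto_neg_atTop_atBot.comp ?_)
    exact (tendsto_rpow_atTop (by positivity)).const_mul_atTop ht
  have hint := integrableOn_Ioi_deriv_of_nonpos hgc.continuousWithinAt hd hneg hlim
  have hval := integral_Ioi_of_hasDerivAt_of_nonpos hgc.continuousWithinAt hd hneg hlim
  rw [hg0] at hval
  have hc : -(Complex.I * (x : ℂ)) ≠ 0 := by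
    simp [hx]
  have hcn : ‖(-(Complex.I * (x : ℂ)))⁻¹‖ = |x|⁻¹ := by simp
  set c : ℂ := -(Complex.I * (x : ℂ)) with hcdef
  set v : ℝ → ℂ := fun ξ => Complex.exp (c * ξ) * c⁻¹ with hv
  set v' : ℝ → ℂ := fun ξ => Complex.exp (c * ξ) with hv'
  set u : ℝ → ℂ := fun ξ => ((g ξ : ℝ) : ℂ) with hu
  set u' : ℝ → ℂ := fun ξ => ((g' ξ : ℝ) : ℂ) with hu'
  have hvn : ∀ ξ, ‖v ξ‖ = |x|⁻¹ := by
    intro ξ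
    simp only [hv]
    rw [norm_mul, hcdef, norm_cexp, one_mul, hcn]
  have hvc : Continuous v := by fun_prop
  have hud : ∀ ξ ∈ Set.Ioi (0 : ℝ), HasDerivAt u (u' ξ) ξ := fun ξ hξ => (hd ξ hξ).ofReal_comp
  have hvd : ∀ ξ ∈ Set.Ioi (0 : ℝ), HasDerivAt v (v' ξ) ξ := by
    intro ξ _
    have h1 : HasDerivAt (fun y : ℝ => c * (y : ℂ)) c ξ := by
      simpa using (Complex.ofRealCLM.hasDerivAt (x := ξ)).const_mul c
    have h2 := (h1.cexp).mul_const c⁻¹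
    simpa [hv', mul_assoc, hc] using h2
  have huv' : IntegrableOn (u * v') (Set.Ioi 0) := by
    refine ((expInt s t hs ht).1).mono' ?_ ?_
    · have : Continuous (u * v') := by
        have : Continuous v' := by fun_prop
        have : Continuous u := by fun_prop
        fun_prop
      exact this.aestronglyMeasurable
    · refine Filter.Eventually.of_forall fun ξ => ?_
      exact (norm_hInt s t x ξ).le
  have hn : ∀ ξ ∈ Set.Ioi (0 : ℝ), ‖u' ξ * v ξ‖ = -(g' ξ) * |x|⁻¹ := by
    intro ξ hξ
    rw [norm_mul, hvn, hu', Complex.norm_real, Real.norm_of_nonpos (hneg ξ hξ)]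
  have hu'i : IntegrableOn u' (Set.Ioi 0) := hint.ofReal
  have hu'v : IntegrableOn (u' * v) (Set.Ioi 0) := by
    refine Integrable.mul_bdd (c := |x|⁻¹) hu'i hvc.aestronglyMeasurable ?_
    exact Filter.Eventually.of_forall fun ξ => (hvn ξ).le
  have huc : Continuous u := by fun_prop
  have hz : Filter.Tendsto (u * v) (nhdsWithin 0 (Set.Ioi 0)) (nhds (c⁻¹)) := by
    have h1 : Continuous (u * v) := huc.mul hvc
    have h2 := (h1.tendsto 0).mono_left (nhdsWithin_le_nhds (s := Set.Ioi (0 : ℝ)))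
    have h3 : (u * v) 0 = c⁻¹ := by
      simp [hu, hv, hg0]
    rwa [h3] at h2
  have hinf : Filter.Tendsto (u * v) Filter.atTop (nhds 0) := by
    rw [tendsto_zero_iff_norm_tendsto_zero]
    have : (fun ξ => ‖(u * v) ξ‖) = fun ξ => g ξ * |x|⁻¹ := by
      funext ξ
      rw [Pi.mul_apply, norm_mul, hvn, hu, Complex.norm_real,
        Real.norm_of_nonneg (Real.exp_pos _).le]
    rw [this]
    simpa using hlim.mul_const |x|⁻¹
  have key := integral_Ioi_mul_deriv_eq_deriv_mul hud hvd huv' hu'v hz hinf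
  have e : ∫ ξ in Set.Ioi (0 : ℝ), hInt s t x ξ = ∫ ξ in Set.Ioi (0 : ℝ), u ξ * v' ξ := rfl
  rw [e, key, zero_sub]
  have hb : ‖∫ ξ in Set.Ioi (0 : ℝ), u' ξ * v ξ‖ ≤ |x|⁻¹ := by
    refine (norm_integral_le_integral_norm _).trans ?_
    rw [setIntegral_congr_fun measurableSet_Ioi hn, integral_mul_const, integral_neg, hval]
    simp
  refine (norm_sub_le _ _).trans ?_
  rw [norm_neg, hcn]
  linarith

/-- Uniform (in `s ≥ s₀`) bounds
`P^{(s)}(x,t) ≤ C min{t^{-1/(2s)}, |x|⁻¹}`. -/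
theorem heat_kernel_uniform_bounds (s₀ : ℝ) (hs₀0 : 0 < s₀) (hs₀1 : s₀ < 1) :
    ∃ C : ℝ, 0 < C ∧ ∀ s : ℝ, s₀ ≤ s → s < 1 → ∀ t : ℝ, 0 < t →
      (∀ x : ℝ, ‖heatK s x t‖ ≤ C * t ^ (-(1 / (2 * s)))) ∧
      (∀ x : ℝ, x ≠ 0 → |x| * ‖heatK s x t‖ ≤ C) := by
  set M := max (Real.Gamma 1) (Real.Gamma (1 / (2 * s₀) + 1)) with hM
  have hM1 : 1 ≤ M := Real.Gamma_one.symm.le.trans (le_max_left _ _)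
  refine ⟨2 * M + 4, by linarith, fun s hs _ t ht => ⟨fun x => ?_, fun x hx => ?_⟩⟩
  · have hs0 : 0 < s := hs₀0.trans_le hs
    have hle : 1 / (2 * s) ≤ 1 / (2 * s₀) := by gcongr
    have hG : Real.Gamma (1 / (2 * s) + 1) ≤ M := by
      refine Real.convexOn_Gamma.le_max_of_mem_Icc (x := 1) (y := 1 / (2 * s₀) + 1) ?_ ?_ ⟨?_, ?_⟩
      · simp
      · simp only [Set.mem_Ioi]
        positivity
      · have : 0 < 1 / (2 * s) := by positivity
        linarith
      · linarith
    have hp : 0 < t ^ (-(1 / (2 * s))) := Real.rpow_pos_of_pos ht _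
    have hb : ∀ y, ‖∫ ξ in Set.Ioi (0 : ℝ), hInt s t y ξ‖ ≤ t ^ (-(1 / (2 * s))) * M := fun y =>
      (half_bound1 s t y hs0 ht).trans (mul_le_mul_of_nonneg_left hG hp.le)
    refine (half_split s t x _ (by positivity) (hb x) (hb (-x))).trans ?_
    nlinarith
  · have hs0 : 0 < s := hs₀0.trans_le hs
    have h2 := half_bound2 s t (-x) hs0 ht (neg_ne_zero.mpr hx)
    rw [abs_neg] at h2
    have h := half_split s t x _ (by positivity) (half_bound2 s t x hs0 ht hx) h2
    have hx' : 0 < |x| := abs_pos.mpr hx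
    calc |x| * ‖heatK s x t‖ ≤ |x| * (2 * (2 * |x|⁻¹)) := by gcongr
      _ = 4 := by field_simp; norm_num
      _ ≤ 2 * M + 4 := by linarith

end
end

section
/- Let x₁ < x₂ < x₃ < x₄ be real numbers, and let γ, γ̃ : [0,1] → {(x,y) ∈ ℝ² : y ≥ 0} be injective continuous curves such that γ(0) = (x₁, 0), γ(1) = (x₃, 0), and γ(t) lies in the open upper half-plane {y > 0} for all t ∈ (0,1), while γ̃(0) = (x₂, 0), γ̃(1) = (x₄, 0), and γ̃(t) lies in the open upper half-plane for all t ∈ (0,1). Then γ and γ̃ intersect in the open upper half-plane: there exist t ∈ (0,1) and t* ∈ (0,1) with γ(t) = γ̃(t*). -/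
/-!
Statement 19: A topological lemma. Two simple continuous curves in the closed upper
half-plane whose interiors lie in the open upper half-plane and whose endpoints
interlace on the real axis (`x₁ < x₂ < x₃ < x₄`) must intersect in the open upper
half-plane.
-/

open Set

lemma edge_aux (l : ℝ → ℂ) (hl : Continuous l) (c : ℂ) (hc : c ≠ 0)
    (h : ∀ t, 0 ≤ (c * Complex.exp (l t)).re) :
    (l 1).im - (l 0).im = (c * Complex.exp (l 1)).arg - (c * Complex.exp (l 0)).arg := by
  have hne : ∀ t, c * Complex.exp (l t) ≠ 0 := fun t => mul_ne_zero hc (Complex.exp_ne_zero _)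
  have hslit : ∀ t, c * Complex.exp (l t) ∈ Complex.slitPlane := by
    intro t
    rw [Complex.mem_slitPlane_iff]
    rcases (h t).lt_or_eq with h1 | h1
    · exact Or.inl h1
    · right
      intro h2
      exact hne t (Complex.ext (by simpa using h1.symm) (by simpa using h2))
  have hg : Continuous fun t => l t - Complex.log (c * Complex.exp (l t)) := by
    refine hl.sub (Continuous.clog (by fun_prop) hslit)
  have hexp : ∀ t, Complex.exp (l t - Complex.log (c * Complex.exp (l t))) = c⁻¹ := by
    intro t
    rw [Complex.exp_sub, Complex.exp_log (hne t)]
    field_simp [Complex.exp_ne_zero (l t)]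
  have key := Complex.isCoveringMap_exp.eq_of_comp_eq hg
    (continuous_const (y := l 0 - Complex.log (c * Complex.exp (l 0))))
    (by funext t; exact Subtype.ext ((hexp t).trans (hexp 0).symm)) 0 rfl
  have k1 := congrArg Complex.im (congrFun key 1)
  simp only [Complex.sub_im, Complex.log_im] at k1
  linarith

lemma arg_I_pos {r : ℝ} (hr : 0 < r) : (Complex.I * (r : ℂ)).arg = Real.pi / 2 := by
  rw [mul_comm, Complex.arg_real_mul _ hr, Complex.arg_I]

lemma arg_negI_pos {r : ℝ} (hr : 0 < r) : (-Complex.I * (r : ℂ)).arg = -(Real.pi / 2) := by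
  rw [mul_comm, Complex.arg_real_mul _ hr, Complex.arg_neg_I]

lemma arg_I_neg {r : ℝ} (hr : r < 0) : (Complex.I * (r : ℂ)).arg = -(Real.pi / 2) := by
  rw [← arg_negI_pos (neg_pos.2 hr)]; push_cast; ring_nf

lemma arg_negI_neg {r : ℝ} (hr : r < 0) : (-Complex.I * (r : ℂ)).arg = Real.pi / 2 := by
  rw [← arg_I_pos (neg_pos.2 hr)]; push_cast; ring_nf

/-- Interlacing simple arcs in the closed upper half-plane meet in
the open upper half-plane. -/
theorem interlacing_arcs_intersect (x₁ x₂ x₃ x₄ : ℝ)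
    (h12 : x₁ < x₂) (h23 : x₂ < x₃) (h34 : x₃ < x₄)
    (γ γ' : ℝ → ℝ × ℝ)
    (hγcont : ContinuousOn γ (Icc 0 1)) (hγinj : InjOn γ (Icc 0 1))
    (hγ0 : γ 0 = (x₁, 0)) (hγ1 : γ 1 = (x₃, 0))
    (hγup : ∀ t ∈ Ioo (0 : ℝ) 1, 0 < (γ t).2)
    (hγ'cont : ContinuousOn γ' (Icc 0 1)) (hγ'inj : InjOn γ' (Icc 0 1))
    (hγ'0 : γ' 0 = (x₂, 0)) (hγ'1 : γ' 1 = (x₄, 0))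
    (hγ'up : ∀ t ∈ Ioo (0 : ℝ) 1, 0 < (γ' t).2) :
    ∃ t ∈ Ioo (0 : ℝ) 1, ∃ t' ∈ Ioo (0 : ℝ) 1, γ t = γ' t' := by
  by_contra hcon
  push Not at hcon
  have hp : ∀ t : ℝ, t ∈ Icc (0:ℝ) 1 → t = 0 ∨ t = 1 ∨ t ∈ Ioo (0:ℝ) 1 := by
    intro t ht
    rcases ht.1.eq_or_lt with h | h
    · exact Or.inl h.symm
    · rcases ht.2.eq_or_lt with h' | h'
      · exact Or.inr (Or.inl h')
      · exact Or.inr (Or.inr ⟨h, h'⟩)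
  have hnn : ∀ t ∈ Icc (0:ℝ) 1, 0 ≤ (γ t).2 := by
    intro t ht
    rcases hp t ht with rfl | rfl | h
    · simp [hγ0]
    · simp [hγ1]
    · exact (hγup t h).le
  have hnn' : ∀ t ∈ Icc (0:ℝ) 1, 0 ≤ (γ' t).2 := by
    intro t ht
    rcases hp t ht with rfl | rfl | h
    · simp [hγ'0]
    · simp [hγ'1]
    · exact (hγ'up t h).le
  have hdis : ∀ s ∈ Icc (0:ℝ) 1, ∀ t ∈ Icc (0:ℝ) 1, γ s ≠ γ' t := by
    intro s hs t ht he
    have he1 := congrArg Prod.fst he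
    have he2 := congrArg Prod.snd he
    rcases hp s hs with rfl | rfl | h <;> rcases hp t ht with rfl | rfl | h'
    · simp only [hγ0, hγ'0] at he1; linarith
    · simp only [hγ0, hγ'1] at he1; linarith
    · have := hγ'up t h'
      simp only [hγ0] at he2; linarith
    · simp only [hγ1, hγ'0] at he1; linarith
    · simp only [hγ1, hγ'1] at he1; linarith
    · have := hγ'up t h'
      simp only [hγ1] at he2; linarith
    · have := hγup s h
      simp only [hγ'0] at he2; linarith
    · have := hγup s h
      simp only [hγ'1] at he2; linarith
    · exact hcon s h t h' he
  let q : ℝ → ℝ := fun t => (projIcc (0:ℝ) 1 zero_le_one t : ℝ)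
  have hqm : ∀ t, q t ∈ Icc (0:ℝ) 1 := fun t => (projIcc (0:ℝ) 1 zero_le_one t).2
  have hqc : Continuous q := continuous_subtype_val.comp continuous_projIcc
  have hq0 : q 0 = 0 := by simp [q]
  have hq1 : q 1 = 1 := by simp [q]
  have hc : Continuous (fun t => γ (q t)) := hγcont.comp_continuous hqc hqm
  have hc' : Continuous (fun t => γ' (q t)) := hγ'cont.comp_continuous hqc hqm
  let F : C(ℝ × ℝ, ℂ) := ⟨fun p => (((γ (q p.1)).1 - (γ' (q p.2)).1 : ℝ) : ℂ)
      + (((γ (q p.1)).2 - (γ' (q p.2)).2 : ℝ) : ℂ) * Complex.I, by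
    have h1 : Continuous (fun p : ℝ × ℝ => γ (q p.1)) := hc.comp continuous_fst
    have h2 : Continuous (fun p : ℝ × ℝ => γ' (q p.2)) := hc'.comp continuous_snd
    exact (Complex.continuous_ofReal.comp (h1.fst.sub h2.fst)).add
      ((Complex.continuous_ofReal.comp (h1.snd.sub h2.snd)).mul continuous_const)⟩
  have hFre : ∀ s t, (F (s, t)).re = (γ (q s)).1 - (γ' (q t)).1 := by intro s t; simp [F]
  have hFim : ∀ s t, (F (s, t)).im = (γ (q s)).2 - (γ' (q t)).2 := by intro s t; simp [F]
  have hF0 : ∀ p, F p ≠ 0 := by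
    rintro ⟨s, t⟩ h
    apply hdis _ (hqm s) _ (hqm t)
    have a1 := hFre s t
    have a2 := hFim s t
    rw [h] at a1 a2
    simp only [Complex.zero_re, Complex.zero_im] at a1 a2
    exact Prod.ext (by linarith) (by linarith)
  obtain ⟨L, ⟨-, hL⟩, -⟩ := Complex.isCoveringMapOn_exp.existsUnique_continuousMap_lifts F
    (a₀ := (0, 0)) (e₀ := Complex.log (F (0, 0))) (Complex.exp_log (hF0 _)) (fun a => hF0 a)
  have hL : ∀ s t, Complex.exp (L (s, t)) = F (s, t) := fun s t => congrFun hL (s, t)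
  have hI : Complex.I ≠ 0 := Complex.I_ne_zero
  have e1 := edge_aux (fun s => L (s, 0)) (by fun_prop) (-Complex.I) (neg_ne_zero.2 hI) (by
    intro s
    have := hnn _ (hqm s)
    simp [hL, hFim, hq0, hγ'0, this])
  have e2 := edge_aux (fun t => L (1, t)) (by fun_prop) Complex.I hI (by
    intro s
    have := hnn' _ (hqm s)
    simp [hL, hFim, hq1, hγ1, this])
  have e3 := edge_aux (fun s => L (s, 1)) (by fun_prop) (-Complex.I) (neg_ne_zero.2 hI) (by
    intro s
    have := hnn _ (hqm s)
    simp [hL, hFim, hq1, hγ'1, this])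
  have e4 := edge_aux (fun t => L (0, t)) (by fun_prop) Complex.I hI (by
    intro s
    have := hnn' _ (hqm s)
    simp [hL, hFim, hq0, hγ0, this])
  have f00 : F (0, 0) = ((x₁ - x₂ : ℝ) : ℂ) := by
    apply Complex.ext
    · rw [hFre, hq0, hγ0, hγ'0, Complex.ofReal_re]
    · rw [hFim, hq0, hγ0, hγ'0, Complex.ofReal_im]; simp
  have f10 : F (1, 0) = ((x₃ - x₂ : ℝ) : ℂ) := by
    apply Complex.ext
    · rw [hFre, hq0, hq1, hγ1, hγ'0, Complex.ofReal_re]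
    · rw [hFim, hq0, hq1, hγ1, hγ'0, Complex.ofReal_im]; simp
  have f01 : F (0, 1) = ((x₁ - x₄ : ℝ) : ℂ) := by
    apply Complex.ext
    · rw [hFre, hq0, hq1, hγ0, hγ'1, Complex.ofReal_re]
    · rw [hFim, hq0, hq1, hγ0, hγ'1, Complex.ofReal_im]; simp
  have f11 : F (1, 1) = ((x₃ - x₄ : ℝ) : ℂ) := by
    apply Complex.ext
    · rw [hFre, hq1, hγ1, hγ'1, Complex.ofReal_re]
    · rw [hFim, hq1, hγ1, hγ'1, Complex.ofReal_im]; simp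
  simp only [hL] at e1 e2 e3 e4
  rw [f10, f00, arg_negI_pos (by linarith), arg_negI_neg (by linarith)] at e1
  rw [f11, f10, arg_I_neg (by linarith), arg_I_pos (by linarith)] at e2
  rw [f11, f01, arg_negI_neg (by linarith), arg_negI_neg (by linarith)] at e3
  rw [f01, f00, arg_I_neg (by linarith), arg_I_neg (by linarith)] at e4
  have := Real.pi_pos
  linarith
end
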